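/- Let X be a random variable with values in a standard Borel space and let Z = f(X) for a measurable function f, where the distribution of Z is non-atomic. Then the mutual information I(X; Z), defined as the Kullback–Leibler divergence of the joint law of (X, Z) from the product of the marginal laws, is infinite: I(X; Z) = ∞. -/

import Mathlib

open MeasureTheory ProbabilityTheory
open scoped ENNReal Classical

/-- Kullback–Leibler divergence `KL(μ ‖ ν) ∈ [0, ∞]`. -/
noncomputable def klDiv {α : Type*} [MeasurableSpace α] (μ ν : Measure α) : ℝ≥0∞ :=
  if μ ≪ ν ∧ Integrable (llr μ ν) μ then ENNReal.ofReal (∫ a, llr μ ν a ∂μ) else ⊤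

/-- Mutual information `I(A; B) ∈ [0, ∞]`, defined as the KL divergence of the joint law of
`(A, B)` from the product of the marginal laws. -/
noncomputable def miKL {Ω α β : Type*} [MeasurableSpace Ω] [MeasurableSpace α]
    [MeasurableSpace β] (μ : Measure Ω) (A : Ω → α) (B : Ω → β) : ℝ≥0∞ :=
  klDiv (μ.map (fun ω => (A ω, B ω))) ((μ.map A).prod (μ.map B))

/-- If `X` takes values in a standard Borel space and `Z = f(X)` for a
measurable `f` with non-atomic law, then `I(X; Z) = ∞`. -/
theorem stmt6
    {Ω 𝒳 𝒵 : Type*} [MeasurableSpace Ω]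
    [MeasurableSpace 𝒳] [StandardBorelSpace 𝒳]
    [MeasurableSpace 𝒵] [StandardBorelSpace 𝒵]
    (μ : Measure Ω) [IsProbabilityMeasure μ]
    (X : Ω → 𝒳) (hX : Measurable X)
    (f : 𝒳 → 𝒵) (hf : Measurable f)
    -- the distribution of `Z = f(X)` is non-atomic
    (hna : ∀ z : 𝒵, μ.map (fun ω => f (X ω)) {z} = 0) :
    miKL μ X (fun ω => f (X ω)) = ⊤ := by
  have hS : MeasurableSet {p : 𝒳 × 𝒵 | f p.1 = p.2} :=
    measurableSet_eq_fun (hf.comp measurable_fst) measurable_snd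
  have hZ : Measurable (fun ω => f (X ω)) := hf.comp hX
  unfold miKL klDiv
  refine if_neg ?_
  rintro ⟨hac, -⟩
  have : IsProbabilityMeasure (μ.map (fun ω => f (X ω))) :=
    Measure.isProbabilityMeasure_map hZ.aemeasurable
  have h0 : ((μ.map X).prod (μ.map (fun ω => f (X ω)))) {p : 𝒳 × 𝒵 | f p.1 = p.2} = 0 := by
    rw [Measure.measure_prod_null hS]
    refine Filter.Eventually.of_forall fun x => ?_
    have hx : Prod.mk x ⁻¹' {p : 𝒳 × 𝒵 | f p.1 = p.2} = {f x} := by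
      ext z
      simp [eq_comm]
    simp only [hx, hna, Pi.zero_apply]
  have h1 := hac h0
  rw [Measure.map_apply (hX.prodMk hZ) hS] at h1
  simp at h1
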